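/- Let S ⊆ ℝ² satisfy (H2). Then S is either a singleton, or a 1-dimensional manifold without boundary of class C²; that is, near each of its points S coincides, in suitable orthonormal coordinates, with the graph of a C² function defined on an open interval. -/

import Mathlib

open Metric Set Real

noncomputable section

abbrev E2 := EuclideanSpace ℝ (Fin 2)

/-- The point of the Euclidean plane with coordinates `(a, b)`. -/
def pt (a b : ℝ) : E2 := (EuclideanSpace.equiv (Fin 2) ℝ).symm ![a, b]

/-- `S` is, near `p`, in suitable orthonormal coordinates (i.e. up to a rigid motion `e`),
the graph of a `C²` function over an open interval. -/
def IsC2GraphAt (S : Set E2) (p : E2) : Prop :=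
  ∃ (e : E2 ≃ᵃⁱ[ℝ] E2) (U : Set E2) (g : ℝ → ℝ) (a b : ℝ),
    IsOpen U ∧ p ∈ U ∧ a < b ∧ ContDiff ℝ 2 g ∧
    e '' (S ∩ U) = (fun t => pt t (g t)) '' Set.Ioo a b

open Filter Topology

@[simp] lemma pt_apply_zero (a b : ℝ) : pt a b 0 = a := rfl

@[simp] lemma pt_apply_one (a b : ℝ) : pt a b 1 = b := rfl

lemma inner_eq_coord (x y : E2) : inner ℝ x y = x 0 * y 0 + x 1 * y 1 := by
  simp [PiLp.inner_apply, Fin.sum_univ_two, mul_comm]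

lemma norm_sq_eq_coord (x : E2) : ‖x‖ ^ 2 = x 0 ^ 2 + x 1 ^ 2 := by
  rw [← real_inner_self_eq_norm_sq, inner_eq_coord]; ring

/-- Rotation by a right angle. -/
def rot (x : E2) : E2 := pt (-(x 1)) (x 0)

@[simp] lemma rot_apply_zero (x : E2) : rot x 0 = -(x 1) := rfl

@[simp] lemma rot_apply_one (x : E2) : rot x 1 = x 0 := rfl

lemma norm_rot (x : E2) : ‖rot x‖ = ‖x‖ := by
  rw [← sq_eq_sq₀ (norm_nonneg _) (norm_nonneg _), norm_sq_eq_coord, norm_sq_eq_coord]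
  simp; ring

lemma inner_rot_self (x : E2) : inner ℝ (rot x) x = 0 := by
  rw [inner_eq_coord]; simp; ring

lemma eq_smul_add_smul_rot {m : E2} (hm : ‖m‖ = 1) (x : E2) :
    x = inner ℝ x m • m + inner ℝ x (rot m) • rot m := by
  have h := norm_sq_eq_coord m
  rw [hm] at h
  ext i
  fin_cases i
  · simp [inner_eq_coord]; linear_combination (x 0) * h
  · simp [inner_eq_coord]; linear_combination (x 1) * h

lemma norm_sq_eq_of_orthonormal {τ n : E2} (hτ : ‖τ‖ = 1) (hn : ‖n‖ = 1) (h : inner ℝ τ n = 0)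
    (w : E2) : ‖w‖ ^ 2 = inner ℝ w τ ^ 2 + inner ℝ w n ^ 2 := by
  have h1 := eq_smul_add_smul_rot hn τ
  rw [h, zero_smul, zero_add] at h1
  have h2 : inner ℝ τ (rot n) ^ 2 = 1 := by
    have := congrArg (fun x => ‖x‖ ^ 2) h1
    simp only [norm_smul, norm_rot, hn, hτ, mul_one, one_pow, Real.norm_eq_abs, sq_abs] at this
    exact this.symm
  rw [h1, inner_smul_right, mul_pow, h2]
  have h3 := norm_sq_eq_coord n
  rw [hn] at h3
  rw [norm_sq_eq_coord, inner_eq_coord, inner_eq_coord, rot_apply_zero, rot_apply_one]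
  linear_combination (w 0 ^ 2 + w 1 ^ 2) * h3

/-- `S` is nonempty, closed and proximally `C²` of radius `r`. -/
structure IsProxSmooth (S : Set E2) (r : ℝ) : Prop where
  pos : 0 < r
  nonempty : S.Nonempty
  closed : IsClosed S
  contDiffOn : ContDiffOn ℝ 2 (fun x => infDist x S) {x | 0 < infDist x S ∧ infDist x S < r}

/-- The open tube of radius `r` around `S`, with `S` removed. -/
def tube (S : Set E2) (r : ℝ) : Set E2 := {x | 0 < infDist x S ∧ infDist x S < r}

lemma isOpen_tube (S : Set E2) (r : ℝ) : IsOpen (tube S r) :=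
  (isOpen_lt continuous_const (continuous_infDist_pt S)).inter
    (isOpen_lt (continuous_infDist_pt S) continuous_const)

/-- The gradient of the distance function. -/
def unitNormal (S : Set E2) (x : E2) : E2 :=
  pt (fderiv ℝ (fun y => infDist y S) x (pt 1 0)) (fderiv ℝ (fun y => infDist y S) x (pt 0 1))

/-- The metric projection on `S`, expressed through the gradient of the distance function. -/
def footPoint (S : Set E2) (x : E2) : E2 := x - infDist x S • unitNormal S x

lemma contDiff_pt : ContDiff ℝ 2 (fun a : ℝ × ℝ => pt a.1 a.2) := by
  rw [contDiff_euclidean]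
  intro i
  fin_cases i
  · exact contDiff_fst
  · exact contDiff_snd

lemma inner_unitNormal (S : Set E2) (x v : E2) :
    inner ℝ (unitNormal S x) v = fderiv ℝ (fun y => infDist y S) x v := by
  have hv : v = v 0 • pt 1 0 + v 1 • pt 0 1 := by
    ext i; fin_cases i <;> simp
  conv_rhs => rw [hv]
  rw [map_add, map_smul, map_smul, inner_eq_coord]
  simp [unitNormal, mul_comm]

namespace IsProxSmooth

variable {S : Set E2} {r : ℝ}

lemma contDiffAt_infDist (H : IsProxSmooth S r) {x : E2} (hx : x ∈ tube S r) :
    ContDiffAt ℝ 2 (fun y => infDist y S) x :=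
  H.contDiffOn.contDiffAt ((isOpen_tube S r).mem_nhds hx)

lemma contDiffAt_unitNormal (H : IsProxSmooth S r) {x : E2} (hx : x ∈ tube S r) :
    ContDiffAt ℝ 1 (unitNormal S) x := by
  have h : ContDiffAt ℝ 1 (fderiv ℝ (fun y => infDist y S)) x :=
    (H.contDiffAt_infDist hx).fderiv_right (by norm_num)
  exact (contDiff_pt.of_le (by norm_num)).contDiffAt.comp x
    ((h.clm_apply contDiffAt_const).prodMk (h.clm_apply contDiffAt_const))

lemma contDiffAt_footPoint (H : IsProxSmooth S r) {x : E2} (hx : x ∈ tube S r) :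
    ContDiffAt ℝ 1 (footPoint S) x :=
  contDiffAt_id.sub (((H.contDiffAt_infDist hx).of_le (by norm_num)).smul
    (H.contDiffAt_unitNormal hx))

lemma hasFDerivAt_infDist (H : IsProxSmooth S r) {x : E2} (hx : x ∈ tube S r) :
    HasFDerivAt (fun y => infDist y S) (innerSL ℝ (unitNormal S x)) x := by
  have heq : innerSL ℝ (unitNormal S x) = fderiv ℝ (fun y => infDist y S) x := by
    ext v
    exact inner_unitNormal S x v
  rw [heq]
  exact ((H.contDiffAt_infDist hx).differentiableAt (by norm_num)).hasFDerivAt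

lemma norm_unitNormal_le (x : E2) : ‖unitNormal S x‖ ≤ 1 := by
  have h1 : ‖fderiv ℝ (fun y => infDist y S) x‖ ≤ (1 : NNReal) :=
    norm_fderiv_le_of_lipschitz ℝ (lipschitz_infDist_pt S)
  have h2 := inner_unitNormal S x (unitNormal S x)
  rw [real_inner_self_eq_norm_sq] at h2
  have h3 := (fderiv ℝ (fun y => infDist y S) x).le_opNorm (unitNormal S x)
  rw [← h2, Real.norm_of_nonneg (by positivity)] at h3
  simp only [NNReal.coe_one] at h1
  nlinarith [norm_nonneg (unitNormal S x)]

lemma unitNormal_eq (H : IsProxSmooth S r) {x q : E2} (hx : x ∈ tube S r) (hq : q ∈ S)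
    (hd : infDist x S = dist x q) :
    infDist x S • unitNormal S x = x - q ∧ ‖unitNormal S x‖ = 1 := by
  have hpos : 0 < infDist x S := hx.1
  have hn : infDist x S = ‖x - q‖ := by rw [hd, dist_eq_norm]
  have hline : ∀ s ∈ Icc (0 : ℝ) 1,
      infDist (x + s • (q - x)) S = infDist x S - s * infDist x S := by
    intro s hs
    apply le_antisymm
    · refine (infDist_le_dist_of_mem hq).trans ?_
      rw [dist_eq_norm, show x + s • (q - x) - q = (1 - s) • (x - q) by module, norm_smul,
        ← hn, Real.norm_of_nonneg (by linarith [hs.2])]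
      linarith
    · have := infDist_le_infDist_add_dist (s := S) (x := x) (y := x + s • (q - x))
      rw [dist_eq_norm, show x - (x + s • (q - x)) = s • (x - q) by module, norm_smul,
        ← hn, Real.norm_of_nonneg hs.1] at this
      linarith
  have hder : HasDerivAt (fun s : ℝ => infDist (x + s • (q - x)) S)
      (inner ℝ (unitNormal S x) (q - x)) 0 := by
    have h1 : HasDerivAt (fun s : ℝ => x + s • (q - x)) (q - x) 0 := by
      simpa using ((hasDerivAt_id (0 : ℝ)).smul_const (q - x)).const_add x
    have h2 : HasFDerivAt (fun y => infDist y S) (innerSL ℝ (unitNormal S x))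
        (x + (0 : ℝ) • (q - x)) := by simpa using H.hasFDerivAt_infDist hx
    exact h2.comp_hasDerivAt (0 : ℝ) h1
  have hder2 : HasDerivAt (fun s : ℝ => infDist x S - s * infDist x S) (-infDist x S) 0 := by
    simpa using ((hasDerivAt_id (0 : ℝ)).mul_const (infDist x S)).const_sub (infDist x S)
  have heq : inner ℝ (unitNormal S x) (q - x) = -infDist x S := by
    have h1 := hder.hasDerivWithinAt (s := Icc 0 1)
    have h2 := (hder2.hasDerivWithinAt (s := Icc 0 1)).congr hline (hline 0 (by simp))
    exact (uniqueDiffOn_Icc_zero_one 0 (by simp)).eq_deriv _ h1 h2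
  have hle := norm_unitNormal_le (S := S) x
  have hsub : inner ℝ (unitNormal S x) (x - q) = infDist x S := by
    rw [← neg_sub q x, inner_neg_right, heq, neg_neg]
  have hz : ‖infDist x S • unitNormal S x - (x - q)‖ ^ 2 ≤ 0 := by
    rw [norm_sub_sq_real, norm_smul, inner_smul_left, hsub, ← hn, Real.norm_of_nonneg hpos.le]
    simp only [conj_trivial]
    nlinarith [mul_pos hpos hpos, norm_nonneg (unitNormal S x),
      mul_le_one₀ hle (norm_nonneg _) hle]
  have h0 : infDist x S • unitNormal S x = x - q := by
    have : ‖infDist x S • unitNormal S x - (x - q)‖ = 0 := by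
      nlinarith [norm_nonneg (infDist x S • unitNormal S x - (x - q))]
    exact sub_eq_zero.mp (norm_eq_zero.mp this)
  refine ⟨h0, ?_⟩
  have := congrArg norm h0
  rw [norm_smul, ← hn, Real.norm_of_nonneg hpos.le] at this
  exact (mul_eq_left₀ hpos.ne').mp this

lemma footPoint_eq (H : IsProxSmooth S r) {x q : E2} (hx : x ∈ tube S r) (hq : q ∈ S)
    (hd : infDist x S = dist x q) : footPoint S x = q := by
  rw [footPoint, (H.unitNormal_eq hx hq hd).1, sub_sub_cancel]

lemma footPoint_mem (H : IsProxSmooth S r) {x : E2} (hx : x ∈ tube S r) :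
    footPoint S x ∈ S := by
  obtain ⟨q, hq, hd⟩ := H.closed.exists_infDist_eq_dist H.nonempty x
  rwa [H.footPoint_eq hx hq hd]

lemma norm_unitNormal (H : IsProxSmooth S r) {x : E2} (hx : x ∈ tube S r) :
    ‖unitNormal S x‖ = 1 := by
  obtain ⟨q, hq, hd⟩ := H.closed.exists_infDist_eq_dist H.nonempty x
  exact (H.unitNormal_eq hx hq hd).2

lemma footPoint_add (x : E2) : footPoint S x + infDist x S • unitNormal S x = x := by
  simp [footPoint]

lemma exists_infDist_add_smul (H : IsProxSmooth S r) {x : E2} (hx : x ∈ tube S r) :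
    ∃ ε > 0, ∀ h ∈ Ioo 0 ε, infDist (x + h • unitNormal S x) S = infDist x S + h := by
  obtain ⟨α, hα0, ε, hε, hα⟩ :=
    (H.contDiffAt_unitNormal hx).exists_forall_mem_closedBall_exists_eq_forall_mem_Ioo_hasDerivAt₀ 0
  simp only [zero_sub, zero_add] at hα
  have hcont : ContinuousAt α 0 := (hα 0 ⟨by linarith, hε⟩).continuousAt
  have hev : ∀ᶠ s in 𝓝 (0 : ℝ), α s ∈ tube S r :=
    hcont.eventually (by rw [hα0]; exact (isOpen_tube S r).mem_nhds hx)
  obtain ⟨δ, hδ, hδ'⟩ := Metric.eventually_nhds_iff.mp hev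
  refine ⟨min ε δ, lt_min hε hδ, fun h hh => ?_⟩
  have hh0 : 0 < h := hh.1
  have hin : ∀ s ∈ Icc 0 h, α s ∈ tube S r ∧ HasDerivAt α (unitNormal S (α s)) s := by
    intro s hs
    have h1 : s < min ε δ := hs.2.trans_lt hh.2
    refine ⟨hδ' ?_, hα s ⟨by linarith [hs.1], h1.trans_le (min_le_left _ _)⟩⟩
    rw [Real.dist_eq, sub_zero, abs_of_nonneg hs.1]
    exact h1.trans_le (min_le_right _ _)
  have hlen : ‖α h - x‖ ≤ h := by
    have := (convex_Icc (0 : ℝ) h).norm_image_sub_le_of_norm_hasDerivWithin_le (f := α)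
      (C := 1) (fun s hs => (hin s hs).2.hasDerivWithinAt)
      (fun s hs => norm_unitNormal_le _) (left_mem_Icc.mpr hh0.le) (right_mem_Icc.mpr hh0.le)
    simpa [hα0, abs_of_pos hh0] using this
  have hgrow : infDist (α h) S = infDist x S + h := by
    have hd : ∀ s ∈ Icc 0 h, HasDerivAt (fun s => infDist (α s) S - s) 0 s := by
      intro s hs
      have h1 : HasDerivAt (fun s => infDist (α s) S)
          (inner ℝ (unitNormal S (α s)) (unitNormal S (α s))) s :=
        (H.hasFDerivAt_infDist (hin s hs).1).comp_hasDerivAt s (hin s hs).2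
      rw [real_inner_self_eq_norm_sq, H.norm_unitNormal (hin s hs).1, one_pow] at h1
      have h2 := h1.sub (hasDerivAt_id s)
      rw [sub_self] at h2
      exact h2
    have := constant_of_has_deriv_right_zero (fun s hs => (hd s hs).continuousAt.continuousWithinAt)
      (fun s hs => (hd s ⟨hs.1, hs.2.le⟩).hasDerivWithinAt) h (right_mem_Icc.mpr hh0.le)
    simp only [hα0, sub_zero] at this
    linarith
  have hd0 : 0 < infDist x S := hx.1
  have hfar : infDist x S + h ≤ ‖(α h - x) + infDist x S • unitNormal S x‖ := by
    rw [← hgrow]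
    refine (infDist_le_dist_of_mem (H.footPoint_mem hx)).trans (le_of_eq ?_)
    rw [dist_eq_norm, footPoint]
    congr 1
    module
  have hnn := H.norm_unitNormal hx
  have heq : α h = x + h • unitNormal S x := by
    have h1 : (infDist x S + h) ^ 2 ≤ ‖(α h - x) + infDist x S • unitNormal S x‖ ^ 2 :=
      pow_le_pow_left₀ (by positivity) hfar 2
    rw [norm_add_sq_real, inner_smul_right, norm_smul, hnn, Real.norm_of_nonneg hd0.le] at h1
    have h2 : ‖(α h - x) - h • unitNormal S x‖ ^ 2 ≤ 0 := by
      rw [norm_sub_sq_real, inner_smul_right, norm_smul, hnn, Real.norm_of_nonneg hh0.le]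
      have h3 : ‖α h - x‖ ^ 2 ≤ h ^ 2 := pow_le_pow_left₀ (norm_nonneg _) hlen 2
      have h4 : h ≤ inner ℝ (α h - x) (unitNormal S x) := by
        by_contra! hc
        nlinarith [mul_pos hd0 (sub_pos.mpr hc)]
      nlinarith
    have h3 : ‖(α h - x) - h • unitNormal S x‖ = 0 := by
      nlinarith [norm_nonneg ((α h - x) - h • unitNormal S x)]
    have := sub_eq_zero.mp (norm_eq_zero.mp h3)
    rw [← this]; abel
  rw [← heq, hgrow]

/-- Distances grow at unit speed along a normal ray, up to the edge of the tube. -/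
lemma infDist_footPoint_add (H : IsProxSmooth S r) {x : E2} (hx : x ∈ tube S r) {t : ℝ}
    (ht : t ∈ Icc 0 r) : infDist (footPoint S x + t • unitNormal S x) S = t := by
  have hd0 : 0 < infDist x S := hx.1
  have hp := H.footPoint_mem hx
  have hn := H.norm_unitNormal hx
  set p := footPoint S x with hpdef
  set n := unitNormal S x with hndef
  have hxe : p + infDist x S • n = x := footPoint_add x
  have hle : ∀ s ≥ 0, infDist (p + s • n) S ≤ s := by
    intro s hs
    refine (infDist_le_dist_of_mem hp).trans (le_of_eq ?_)
    rw [dist_eq_norm, add_sub_cancel_left, norm_smul, hn, Real.norm_of_nonneg hs, mul_one]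
  have hlip : ∀ s t, s ≤ t → infDist (p + t • n) S ≤ infDist (p + s • n) S + (t - s) := by
    intro s t hst
    have := infDist_le_infDist_add_dist (s := S) (x := p + t • n) (y := p + s • n)
    rwa [dist_eq_norm, show p + t • n - (p + s • n) = (t - s) • n by module, norm_smul, hn,
      Real.norm_of_nonneg (by linarith), mul_one] at this
  have hcont : Continuous fun s : ℝ => infDist (p + s • n) S :=
    (continuous_infDist_pt S).comp (by fun_prop)
  have hcl : IsClosed {s : ℝ | infDist (p + s • n) S = s} := isClosed_eq hcont continuous_id
  have hup : Icc (infDist x S) r ⊆ {s : ℝ | infDist (p + s • n) S = s} := by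
    refine (hcl.inter isClosed_Icc).Icc_subset_of_forall_exists_gt (by simp [hxe]) ?_
    rintro s ⟨hs, hs1, hs2⟩ y hy
    simp only [mem_ofPred_eq] at hs
    have hs0 : 0 < s := hd0.trans_le hs1
    have hst : p + s • n ∈ tube S r := ⟨by rw [hs]; exact hs0, by rw [hs]; exact hs2⟩
    have hdist : infDist (p + s • n) S = dist (p + s • n) p := by
      rw [hs, dist_eq_norm, add_sub_cancel_left, norm_smul, hn, Real.norm_of_nonneg hs0.le, mul_one]
    have hsn : unitNormal S (p + s • n) = n := by
      have := (H.unitNormal_eq hst hp hdist).1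
      rw [hs, add_sub_cancel_left] at this
      exact smul_right_injective _ hs0.ne' this
    obtain ⟨ε, hε, hε'⟩ := H.exists_infDist_add_smul hst
    rw [hsn, hs] at hε'
    have hy' : s < y := hy
    have hm : 0 < min (ε / 2) (y - s) := lt_min (by linarith) (by linarith)
    refine ⟨s + min (ε / 2) (y - s), ?_, by linarith, by linarith [min_le_right (ε / 2) (y - s)]⟩
    have := hε' (min (ε / 2) (y - s)) ⟨hm, by linarith [min_le_left (ε / 2) (y - s)]⟩
    rw [mem_ofPred_eq, add_smul, ← add_assoc]
    exact this
  by_cases h : infDist x S ≤ t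
  · exact hup ⟨h, ht.2⟩
  · refine le_antisymm (hle t ht.1) ?_
    have := hlip t (infDist x S) (by linarith)
    rw [hxe] at this
    linarith
lemma of_infDist_eq_norm (H : IsProxSmooth S r) {p w : E2} (hp : p ∈ S) (h0 : 0 < ‖w‖)
    (hr : ‖w‖ < r) (hd : infDist (p + w) S = ‖w‖) :
    p + w ∈ tube S r ∧ footPoint S (p + w) = p ∧ ‖w‖ • unitNormal S (p + w) = w := by
  have ht : p + w ∈ tube S r := ⟨by rwa [hd], by rwa [hd]⟩
  have hd' : infDist (p + w) S = dist (p + w) p := by rw [hd, dist_eq_norm, add_sub_cancel_left]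
  refine ⟨ht, H.footPoint_eq ht hp hd', ?_⟩
  have := (H.unitNormal_eq ht hp hd').1
  rwa [hd, add_sub_cancel_left] at this

end IsProxSmooth

/-- The proximal normal cone of `S` at `p`, defined through exterior balls of radius `r`. -/
def normalCone (S : Set E2) (r : ℝ) (p : E2) : Set E2 :=
  {w | ∀ q ∈ S, 2 * r * inner ℝ (q - p) w ≤ ‖w‖ * ‖q - p‖ ^ 2}

lemma smul_mem_normalCone {S : Set E2} {r c : ℝ} {p w : E2} (hc : 0 ≤ c)
    (hw : w ∈ normalCone S r p) : c • w ∈ normalCone S r p := by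
  intro q hq
  rw [inner_smul_right, norm_smul, Real.norm_of_nonneg hc]
  nlinarith [mul_le_mul_of_nonneg_left (hw q hq) hc]

lemma mem_normalCone_of_smul_mem {S : Set E2} {r c : ℝ} {p w : E2} (hc : 0 < c)
    (hw : c • w ∈ normalCone S r p) : w ∈ normalCone S r p := by
  simpa [smul_smul, hc.ne'] using smul_mem_normalCone (inv_nonneg.mpr hc.le) hw

namespace IsProxSmooth

variable {S : Set E2} {r : ℝ}

lemma unitNormal_mem_normalCone (H : IsProxSmooth S r) {x : E2} (hx : x ∈ tube S r) :
    unitNormal S x ∈ normalCone S r (footPoint S x) := by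
  intro q hq
  have h := H.infDist_footPoint_add hx (t := r) ⟨H.pos.le, le_rfl⟩
  have hn := H.norm_unitNormal hx
  set p := footPoint S x
  set n := unitNormal S x
  have h1 : r ≤ ‖(q - p) - r • n‖ := by
    rw [← norm_neg, show -((q - p) - r • n) = p + r • n - q by abel, ← dist_eq_norm]
    exact h.symm.le.trans (infDist_le_dist_of_mem hq)
  have h2 := pow_le_pow_left₀ H.pos.le h1 2
  rw [norm_sub_sq_real, inner_smul_right, norm_smul, hn, Real.norm_of_nonneg H.pos.le] at h2
  rw [hn]
  linarith

lemma infDist_add_of_mem_normalCone (H : IsProxSmooth S r) {p w : E2} (hp : p ∈ S)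
    (hr : ‖w‖ < r) (hw : w ∈ normalCone S r p) : infDist (p + w) S = ‖w‖ := by
  apply le_antisymm
  · refine (infDist_le_dist_of_mem hp).trans (le_of_eq ?_)
    rw [dist_eq_norm, add_sub_cancel_left]
  · obtain ⟨q, hq, hd⟩ := H.closed.exists_infDist_eq_dist H.nonempty (p + w)
    rw [hd, dist_eq_norm, norm_sub_rev, show q - (p + w) = (q - p) - w by abel]
    refine le_of_sq_le_sq ?_ (norm_nonneg _)
    rw [norm_sub_sq_real]
    have h1 : r * (2 * inner ℝ (q - p) w) ≤ r * ‖q - p‖ ^ 2 := by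
      have := mul_le_mul_of_nonneg_right hr.le (sq_nonneg ‖q - p‖)
      linarith [hw q hq]
    linarith [le_of_mul_le_mul_left h1 H.pos]

lemma mem_normalCone_of_infDist (H : IsProxSmooth S r) {p w : E2} (hp : p ∈ S) (h0 : 0 < ‖w‖)
    (hr : ‖w‖ < r) (hd : infDist (p + w) S = ‖w‖) : w ∈ normalCone S r p := by
  obtain ⟨h1, h2, h3⟩ := H.of_infDist_eq_norm hp h0 hr hd
  have := H.unitNormal_mem_normalCone h1
  rw [h2] at this
  rw [← h3]
  exact smul_mem_normalCone h0.le this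

/-- A proximal normal with any constant is one with the uniform constant. -/
lemma mem_normalCone_of_le (H : IsProxSmooth S r) {p w : E2} {C : ℝ} (hp : p ∈ S)
    (hw : ∀ q ∈ S, inner ℝ (q - p) w ≤ C * ‖q - p‖ ^ 2) : w ∈ normalCone S r p := by
  rcases eq_or_ne w 0 with rfl | hw0
  · intro q _; simp
  have hn : 0 < ‖w‖ := norm_pos_iff.mpr hw0
  have hr := H.pos
  obtain ⟨c, hc, hc1, hc2⟩ : ∃ c > 0, c * ‖w‖ < r ∧ 2 * (c * C) ≤ 1 := by
    refine ⟨min (r / (2 * ‖w‖)) (1 / (2 * (|C| + 1))), by positivity, ?_, ?_⟩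
    · calc _ ≤ r / (2 * ‖w‖) * ‖w‖ := by gcongr; exact min_le_left _ _
        _ = r / 2 := by field_simp
        _ < r := by linarith
    · calc _ ≤ 2 * (1 / (2 * (|C| + 1)) * (|C| + 1)) := by
            have hC : C ≤ |C| + 1 := by linarith [le_abs_self C]
            have h1 : min (r / (2 * ‖w‖)) (1 / (2 * (|C| + 1))) * C ≤
              min (r / (2 * ‖w‖)) (1 / (2 * (|C| + 1))) * (|C| + 1) := by gcongr
            have h2 : min (r / (2 * ‖w‖)) (1 / (2 * (|C| + 1))) * (|C| + 1) ≤
              1 / (2 * (|C| + 1)) * (|C| + 1) := by gcongr; exact min_le_right _ _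
            linarith
        _ = 1 := by field_simp
  have hcn : ‖c • w‖ = c * ‖w‖ := by rw [norm_smul, Real.norm_of_nonneg hc.le]
  refine mem_normalCone_of_smul_mem hc (H.mem_normalCone_of_infDist hp (by rw [hcn]; positivity)
    (by rwa [hcn]) (le_antisymm ?_ ?_))
  · refine (infDist_le_dist_of_mem hp).trans (le_of_eq ?_)
    rw [dist_eq_norm, add_sub_cancel_left]
  · obtain ⟨q, hq, hd⟩ := H.closed.exists_infDist_eq_dist H.nonempty (p + c • w)
    rw [hd, dist_eq_norm, norm_sub_rev, show q - (p + c • w) = (q - p) - c • w by abel]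
    refine le_of_sq_le_sq ?_ (norm_nonneg _)
    rw [norm_sub_sq_real, inner_smul_right]
    nlinarith [mul_le_mul_of_nonneg_left (hw q hq) hc.le,
      mul_le_mul_of_nonneg_right hc2 (sq_nonneg ‖q - p‖)]

lemma add_mem_normalCone (H : IsProxSmooth S r) {p v w : E2} (hp : p ∈ S)
    (hv : v ∈ normalCone S r p) (hw : w ∈ normalCone S r p) : v + w ∈ normalCone S r p := by
  have hr := H.pos
  refine H.mem_normalCone_of_le (C := (‖v‖ + ‖w‖) / (2 * r)) hp fun q hq => ?_
  rw [inner_add_right, div_mul_eq_mul_div, le_div_iff₀ (by positivity)]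
  linarith [hv q hq, hw q hq]

lemma tendsto_footPoint (H : IsProxSmooth S r) {x : ℕ → E2} {p : E2} (hp : p ∈ S)
    (hx : ∀ k, x k ∈ tube S r) (hlim : Tendsto x atTop (𝓝 p)) :
    Tendsto (fun k => footPoint S (x k)) atTop (𝓝 p) := by
  have h1 : Tendsto (fun k => infDist (x k) S) atTop (𝓝 0) := by
    have := ((continuous_infDist_pt S).tendsto p).comp hlim
    rwa [infDist_zero_of_mem hp] at this
  have h2 : Tendsto (fun k => infDist (x k) S • unitNormal S (x k)) atTop (𝓝 0) := by
    rw [tendsto_zero_iff_norm_tendsto_zero]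
    refine h1.congr fun k => ?_
    rw [norm_smul, H.norm_unitNormal (hx k), mul_one, Real.norm_of_nonneg infDist_nonneg]
  have h3 := hlim.sub h2
  rw [sub_zero] at h3
  exact h3

lemma mem_normalCone_of_tendsto {p n : E2} {q m : ℕ → E2}
    (hm : ∀ k, m k ∈ normalCone S r (q k)) (hq : Tendsto q atTop (𝓝 p))
    (hmn : Tendsto m atTop (𝓝 n)) : n ∈ normalCone S r p := by
  intro y hy
  have h1 : Tendsto (fun k => y - q k) atTop (𝓝 (y - p)) := hq.const_sub y
  exact le_of_tendsto_of_tendsto' ((h1.inner hmn).const_mul (2 * r))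
    (hmn.norm.mul (h1.norm.pow 2)) fun k => hm k y hy

/-- When `S` has empty interior, no open half-plane contains all normals at a point. -/
lemma exists_normal_inner_nonneg (H : IsProxSmooth S r) (hint : interior S = ∅) {p : E2}
    (hp : p ∈ S) (v : E2) : ∃ n ∈ normalCone S r p, ‖n‖ = 1 ∧ 0 ≤ inner ℝ v n := by
  have hr := H.pos
  have hex : ∀ k : ℕ, ∃ x, x ∉ S ∧ ‖x - (p + (1 / ((k : ℝ) + 1)) • v)‖ ≤ (1 / ((k : ℝ) + 1)) ^ 2 := by
    intro k
    by_contra! hc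
    have : p + (1 / ((k : ℝ) + 1)) • v ∈ interior S := by
      rw [mem_interior_iff_mem_nhds]
      refine Filter.mem_of_superset (Metric.ball_mem_nhds _ (ε := (1 / ((k : ℝ) + 1)) ^ 2)
        (by positivity)) fun x hx => ?_
      by_contra hxS
      rw [mem_ball, dist_eq_norm] at hx
      linarith [hc x hxS]
    rw [hint] at this
    exact this
  choose x hxS hx using hex
  have hε : Tendsto (fun k : ℕ => 1 / ((k : ℝ) + 1)) atTop (𝓝 0) :=
    tendsto_one_div_add_atTop_nhds_zero_nat
  have hlim : Tendsto x atTop (𝓝 p) := by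
    have h1 : Tendsto (fun k => x k - (p + (1 / ((k : ℝ) + 1)) • v)) atTop (𝓝 0) :=
      squeeze_zero_norm hx (by simpa using hε.pow 2)
    have h2 : Tendsto (fun k : ℕ => p + (1 / ((k : ℝ) + 1)) • v) atTop (𝓝 p) := by
      simpa using (hε.smul_const v).const_add p
    simpa using h1.add h2
  have hpos : ∀ k, 0 < infDist (x k) S := fun k =>
    (H.closed.notMem_iff_infDist_pos H.nonempty).mp (hxS k)
  have hev : ∀ᶠ k in atTop, infDist (x k) S < r := by
    have := ((continuous_infDist_pt S).tendsto p).comp hlim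
    rw [infDist_zero_of_mem hp] at this
    exact this.eventually (gt_mem_nhds hr)
  obtain ⟨N, hN⟩ := hev.exists_forall_of_atTop
  have htube : ∀ k, x (k + N) ∈ tube S r := fun k => ⟨hpos _, hN _ (Nat.le_add_left N k)⟩
  have hsph : ∀ k, unitNormal S (x (k + N)) ∈ sphere (0 : E2) 1 := fun k => by
    simp [H.norm_unitNormal (htube k)]
  obtain ⟨n, hn, φ, hφ, hφn⟩ := (isCompact_sphere (0 : E2) 1).tendsto_subseq hsph
  have hφN : Tendsto (fun k => φ k + N) atTop atTop :=
    (tendsto_add_atTop_nat N).comp hφ.tendsto_atTop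
  have hxφ := hlim.comp hφN
  have hεφ := hε.comp hφN
  have hfoot := H.tendsto_footPoint hp (fun k => htube (φ k)) hxφ
  refine ⟨n, mem_normalCone_of_tendsto (fun k => H.unitNormal_mem_normalCone (htube (φ k)))
    hfoot hφn, by simpa using hn, ?_⟩
  have hkey : ∀ k, -(1 / ((k + N : ℕ) + 1 : ℝ)) * (1 + 2 * (‖v‖ + 1) ^ 2 / r) ≤
      inner ℝ v (unitNormal S (x (k + N))) := by
    intro k
    have ht := htube k
    have hcone := H.unitNormal_mem_normalCone ht p hp
    have hfp := footPoint_add (S := S) (x (k + N))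
    have hnn := H.norm_unitNormal ht
    have hxk := hx (k + N)
    have hd : infDist (x (k + N)) S ≤ ‖x (k + N) - p‖ := by
      rw [← dist_eq_norm]; exact infDist_le_dist_of_mem hp
    have hε0 : 0 < 1 / ((k + N : ℕ) + 1 : ℝ) := by positivity
    have hε1 : 1 / ((k + N : ℕ) + 1 : ℝ) ≤ 1 := by
      rw [div_le_one (by positivity)]
      linarith [Nat.cast_nonneg (α := ℝ) (k + N)]
    have hd0 := (hpos (k + N)).le
    generalize infDist (x (k + N)) S = d at *
    generalize unitNormal S (x (k + N)) = m at *
    generalize footPoint S (x (k + N)) = q at *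
    generalize x (k + N) = y at *
    generalize 1 / ((k + N : ℕ) + 1 : ℝ) = ε at *
    have hy : ‖y - p‖ ≤ ε * (‖v‖ + 1) := by
      calc ‖y - p‖ = ‖(y - (p + ε • v)) + ε • v‖ := by congr 1; abel
        _ ≤ ‖y - (p + ε • v)‖ + ‖ε • v‖ := norm_add_le _ _
        _ ≤ ε ^ 2 + ε * ‖v‖ := by
          rw [norm_smul, Real.norm_of_nonneg hε0.le]; linarith
        _ ≤ _ := by nlinarith
    have hq : ‖p - q‖ ≤ 2 * (ε * (‖v‖ + 1)) := by
      calc ‖p - q‖ = ‖d • m - (y - p)‖ := by rw [← hfp]; congr 1; abel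
        _ ≤ ‖d • m‖ + ‖y - p‖ := norm_sub_le _ _
        _ ≤ _ := by rw [norm_smul, hnn, Real.norm_of_nonneg hd0]; linarith
    have hpq : inner ℝ (p - q) m = d - ε * inner ℝ v m - inner ℝ (y - (p + ε • v)) m := by
      have : p - q = d • m - ε • v - (y - (p + ε • v)) := by rw [← hfp]; abel
      rw [this, inner_sub_left, inner_sub_left, inner_smul_left, inner_smul_left,
        real_inner_self_eq_norm_sq, hnn]
      simp
    have herr : inner ℝ (y - (p + ε • v)) m ≤ ε ^ 2 := by
      refine (real_inner_le_norm _ _).trans ?_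
      rw [hnn, mul_one]; exact hxk
    have hq2 := pow_le_pow_left₀ (norm_nonneg _) hq 2
    rw [hnn, one_mul, hpq] at hcone
    have h1 : 2 * r * (-ε * inner ℝ v m - ε ^ 2) ≤ 4 * ε ^ 2 * (‖v‖ + 1) ^ 2 := by
      have : 2 * r * (-ε * inner ℝ v m - ε ^ 2) ≤
        2 * r * (d - ε * inner ℝ v m - inner ℝ (y - (p + ε • v)) m) := by
        gcongr; linarith
      linarith
    have h2 : ε * (r * (-inner ℝ v m)) ≤ ε * (ε * (r + 2 * (‖v‖ + 1) ^ 2)) := by linarith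
    have h3 := le_of_mul_le_mul_left h2 hε0
    have h4 : r * (-ε * (1 + 2 * (‖v‖ + 1) ^ 2 / r)) = -(ε * (r + 2 * (‖v‖ + 1) ^ 2)) := by
      field_simp
    refine le_of_mul_le_mul_left ?_ hr
    rw [h4]
    linarith
  have hl : Tendsto (fun k => -(1 / ((φ k + N : ℕ) + 1 : ℝ)) * (1 + 2 * (‖v‖ + 1) ^ 2 / r)) atTop
      (𝓝 0) := by
    simpa using (hεφ.neg).mul_const (1 + 2 * (‖v‖ + 1) ^ 2 / r)
  exact le_of_tendsto_of_tendsto' hl (tendsto_const_nhds.inner hφn) fun k => hkey (φ k)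

/-- Every point of `S` admits two opposite unit normals. -/
lemma exists_opposite_normals (H : IsProxSmooth S r) (hint : interior S = ∅) {p : E2}
    (hp : p ∈ S) : ∃ m, ‖m‖ = 1 ∧ m ∈ normalCone S r p ∧ -m ∈ normalCone S r p := by
  have hclosed : IsClosed (normalCone S r p) := by
    refine IsSeqClosed.isClosed fun u n hu hn =>
      mem_normalCone_of_tendsto (q := fun _ => p) hu tendsto_const_nhds hn
  have hA : IsCompact (normalCone S r p ∩ sphere 0 1) := (isCompact_sphere _ _).inter_left hclosed
  have hAne : (normalCone S r p ∩ sphere 0 1).Nonempty := by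
    obtain ⟨n, hn, hn1, -⟩ := H.exists_normal_inner_nonneg hint hp 0
    exact ⟨n, hn, by simpa using hn1⟩
  obtain ⟨⟨n, n'⟩, ⟨⟨hn, hn1⟩, ⟨hn', hn1'⟩⟩, hmin⟩ := (hA.prod hA).exists_isMinOn
    (hAne.prod hAne) (f := fun z : E2 × E2 => inner ℝ z.1 z.2) (by fun_prop)
  have hmin' : ∀ a ∈ normalCone S r p, ‖a‖ = 1 → ∀ b ∈ normalCone S r p, ‖b‖ = 1 →
      inner ℝ n n' ≤ inner ℝ a b := fun a ha ha1 b hb hb1 =>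
    hmin (a := (a, b)) ⟨⟨ha, by simpa using ha1⟩, ⟨hb, by simpa using hb1⟩⟩
  simp only [mem_sphere_iff_norm, sub_zero] at hn hn1 hn' hn1'
  obtain ⟨m, hm, hm1, hmle⟩ := H.exists_normal_inner_nonneg hint hp (-(n + n'))
  by_contra! hno
  rw [inner_neg_left, inner_add_left] at hmle
  have hs := hmin' n hn hn1 m hm hm1
  have hs' := hmin' n' hn' hn1' m hm hm1
  set c := inner ℝ n n' with hc
  have hc0 : c ≤ 0 := by linarith
  have hc1 : -1 < c := by
    by_contra! h
    refine hno n hn1 hn ?_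
    have : ‖n + n'‖ ^ 2 ≤ 0 := by
      rw [norm_add_sq_real, hn1, hn1', ← hc]; linarith
    have h0 : ‖n + n'‖ = 0 := by nlinarith [norm_nonneg (n + n')]
    rwa [neg_eq_of_add_eq_zero_right (norm_eq_zero.mp h0)]
  obtain ⟨a, b, hab⟩ : ∃ a b : ℝ, m = a • n + b • n' := by
    have h1 := norm_sq_eq_coord n
    have h2 := norm_sq_eq_coord n'
    rw [inner_eq_coord] at hc
    rw [hn1] at h1
    rw [hn1'] at h2
    have hD : n 0 * n' 1 - n 1 * n' 0 ≠ 0 := by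
      intro h
      have : c ^ 2 = 1 := by
        rw [hc]; linear_combination (-(n 0 * n' 1 - n 1 * n' 0)) * h - h1 - (n 0 ^ 2 + n 1 ^ 2) * h2
      nlinarith
    refine ⟨(m 0 * n' 1 - m 1 * n' 0) / (n 0 * n' 1 - n 1 * n' 0),
      (n 0 * m 1 - n 1 * m 0) / (n 0 * n' 1 - n 1 * n' 0), ?_⟩
    ext i
    fin_cases i
    all_goals
      simp only [Fin.zero_eta, Fin.mk_one, PiLp.add_apply, PiLp.smul_apply, smul_eq_mul]
      rw [div_mul_eq_mul_div, div_mul_eq_mul_div, ← add_div, eq_div_iff hD]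
      ring
  have hmn : inner ℝ n m = a + b * c := by
    rw [hab, inner_add_right, inner_smul_right, inner_smul_right, real_inner_self_eq_norm_sq, hn1,
      ← hc]
    ring
  have hmn' : inner ℝ n' m = a * c + b := by
    rw [hab, inner_add_right, inner_smul_right, inner_smul_right, real_inner_self_eq_norm_sq, hn1',
      real_inner_comm, ← hc]
    ring
  have hmm : a ^ 2 + b ^ 2 + 2 * a * b * c = 1 := by
    have h1 : inner ℝ m m = a * inner ℝ n m + b * inner ℝ n' m := by
      calc inner ℝ m m = inner ℝ (a • n + b • n') m := by rw [← hab]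
        _ = _ := by rw [inner_add_left, inner_smul_left, inner_smul_left]; rfl
    rw [real_inner_self_eq_norm_sq, hm1, hmn, hmn'] at h1
    linarith
  rw [hmn] at hs hmle
  rw [hmn'] at hs' hmle
  have hsum : a + b ≤ 0 := by nlinarith
  have key : ∀ a b : ℝ, a + b ≤ 0 → c ≤ a + b * c → a ^ 2 + b ^ 2 + 2 * a * b * c = 1 → b ≤ 0 := by
    intro a b h1 h2 h3
    by_contra! hb
    have h4 : -a ≤ -c * (1 - b) := by linarith
    have hb1 : b < 1 := by nlinarith
    have h5 : 0 ≤ -a := by linarith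
    have h6 : (-a) ^ 2 ≤ (-c * (1 - b)) ^ 2 := pow_le_pow_left₀ h5 h4 2
    have h7 : (-a) * (b * -c) ≤ (-c * (1 - b)) * (b * -c) :=
      mul_le_mul_of_nonneg_right h4 (by nlinarith)
    nlinarith [mul_pos (show 0 < 1 - b ^ 2 by nlinarith) (show 0 < 1 - c ^ 2 by nlinarith)]
  have hb := key a b hsum hs hmm
  have ha := key b a (by linarith) (by linarith) (by linarith)
  refine hno m hm1 hm ?_
  have : -m = (-a) • n + (-b) • n' := by rw [hab]; module
  rw [this]
  exact H.add_mem_normalCone hp (smul_mem_normalCone (by linarith) hn)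
    (smul_mem_normalCone (by linarith) hn')
lemma eq_singleton_of_normals (H : IsProxSmooth S r) (hconn : IsConnected S) {p m : E2}
    (hp : p ∈ S) (hm1 : ‖m‖ = 1) (h1 : m ∈ normalCone S r p) (h2 : -m ∈ normalCone S r p)
    (h3 : rot m ∈ normalCone S r p) (h4 : -rot m ∈ normalCone S r p) : S = {p} := by
  have hr := H.pos
  have hline : ∀ v, v ∈ normalCone S r p → -v ∈ normalCone S r p → ∀ a : ℝ,
      a • v ∈ normalCone S r p := by
    intro v hv hv' a
    rcases le_total 0 a with ha | ha
    · exact smul_mem_normalCone ha hv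
    · simpa using smul_mem_normalCone (neg_nonneg.mpr ha) hv'
  have hall : ∀ w, w ∈ normalCone S r p := by
    intro w
    rw [eq_smul_add_smul_rot hm1 w]
    exact H.add_mem_normalCone hp (hline m h1 h2 _) (hline _ h3 h4 _)
  have hfar : ∀ q ∈ S, q ∈ ball p r ∪ (closedBall p r)ᶜ ∧ (q ∈ ball p r → q = p) := by
    intro q hq
    have h := hall (q - p) q hq
    rw [real_inner_self_eq_norm_sq] at h
    rcases eq_or_ne q p with rfl | hqp
    · exact ⟨Or.inl (mem_ball_self hr), fun _ => rfl⟩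
    · have hpos : 0 < ‖q - p‖ := norm_pos_iff.mpr (sub_ne_zero.mpr hqp)
      have h' : 2 * r ≤ ‖q - p‖ := le_of_mul_le_mul_right h (by positivity)
      refine ⟨Or.inr ?_, fun hb => ?_⟩
      · rw [mem_compl_iff, mem_closedBall, dist_eq_norm]; linarith
      · rw [mem_ball, dist_eq_norm] at hb; linarith
  have hsub : S ⊆ ball p r := by
    refine hconn.isPreconnected.subset_left_of_subset_union isOpen_ball
      isClosed_closedBall.isOpen_compl ?_ (fun q hq => (hfar q hq).1) ⟨p, hp, mem_ball_self hr⟩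
    exact disjoint_compl_right_iff_subset.mpr ball_subset_closedBall
  exact Set.eq_singleton_iff_unique_mem.mpr ⟨hp, fun q hq => (hfar q hq).2 (hsub hq)⟩

/-- If the opposite of the normal at `y` is not a normal, then the foot point is locally
constant. -/
lemma eventually_footPoint_eq (H : IsProxSmooth S r) (hint : interior S = ∅) {y : E2}
    (hy : y ∈ tube S r) (hbad : -unitNormal S y ∉ normalCone S r (footPoint S y)) :
    ∀ᶠ z in 𝓝 y, footPoint S z = footPoint S y := by
  have hp := H.footPoint_mem hy
  have hn := H.norm_unitNormal hy
  have hnK := H.unitNormal_mem_normalCone hy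
  have hyp := footPoint_add (S := S) y
  have hd : 0 < infDist y S := hy.1
  have hdr : infDist y S < r := hy.2
  set p := footPoint S y
  set n := unitNormal S y
  obtain ⟨m, hm1, hm, hm'⟩ := H.exists_opposite_normals hint hp
  have hline : ∀ a : ℝ, a • m ∈ normalCone S r p := by
    intro a
    rcases le_total 0 a with ha | ha
    · exact smul_mem_normalCone ha hm
    · simpa using smul_mem_normalCone (neg_nonneg.mpr ha) hm'
  have hβ : inner ℝ n (rot m) ≠ 0 := by
    intro h0
    apply hbad
    rw [eq_smul_add_smul_rot hm1 n, h0, zero_smul, add_zero, ← neg_smul]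
    exact hline _
  have hyn : y - p = infDist y S • n := sub_eq_of_eq_add' hyp.symm
  have hnorm : ‖y - p‖ = infDist y S := by
    rw [hyn, norm_smul, hn, mul_one, Real.norm_of_nonneg hd.le]
  have e1 : ∀ᶠ z in 𝓝 y, 0 < inner ℝ n (rot m) * inner ℝ (z - p) (rot m) := by
    refine (show ContinuousAt (fun z => inner ℝ n (rot m) * inner ℝ (z - p) (rot m)) y by
      fun_prop).eventually (lt_mem_nhds ?_)
    simp only [hyn, inner_smul_left, conj_trivial]
    nlinarith [mul_pos hd (mul_self_pos.mpr hβ)]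
  have e2 : ∀ᶠ z in 𝓝 y, 0 < ‖z - p‖ ∧ ‖z - p‖ < r :=
    have hc : ContinuousAt (fun z => ‖z - p‖) y := by fun_prop
    (hc.eventually (lt_mem_nhds (by simpa only [hnorm] using hd))).and
      (hc.eventually (gt_mem_nhds (by simpa only [hnorm] using hdr)))
  filter_upwards [e1, e2] with z hz1 hz2
  have hzK : z - p ∈ normalCone S r p := by
    set b := inner ℝ (z - p) (rot m) / inner ℝ n (rot m) with hb
    have hb0 : 0 ≤ b := by
      rw [hb, ← mul_div_mul_left _ _ hβ]
      exact div_nonneg hz1.le (mul_self_nonneg _)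
    have : z - p = b • n + (inner ℝ (z - p) m - b * inner ℝ n m) • m := by
      conv_rhs => rw [eq_smul_add_smul_rot hm1 n]
      conv_lhs => rw [eq_smul_add_smul_rot hm1 (z - p)]
      have : inner ℝ (z - p) (rot m) = b * inner ℝ n (rot m) := by rw [hb]; field_simp
      rw [this]
      have hrm : ‖rot m‖ = 1 := by rw [norm_rot, hm1]
      simp only [inner_add_left, inner_smul_left, real_inner_self_eq_norm_sq, hm1,
        inner_rot_self, conj_trivial]
      module
    rw [this]
    exact H.add_mem_normalCone hp (smul_mem_normalCone hb0 hnK) (hline _)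
  have := (H.of_infDist_eq_norm hp hz2.1 hz2.2
    (H.infDist_add_of_mem_normalCone hp hz2.2 hzK)).2.1
  rwa [add_sub_cancel] at this

lemma abs_inner_le {p q n : E2} (hn : ‖n‖ = 1) (h1 : n ∈ normalCone S r p)
    (h2 : -n ∈ normalCone S r p) (hq : q ∈ S) : 2 * r * |inner ℝ (q - p) n| ≤ ‖q - p‖ ^ 2 := by
  have a := h1 q hq
  have b := h2 q hq
  rw [norm_neg, inner_neg_right, hn] at b
  rw [hn] at a
  rcases abs_cases (inner ℝ (q - p) n) with ⟨h, _⟩ | ⟨h, _⟩ <;> rw [h] <;> linarith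

/-- A direction along which the foot point is critical is itself normal. -/
lemma mem_normalCone_of_hasDerivAt_zero (H : IsProxSmooth S r) (hint : interior S = ∅) {y τ : E2}
    (hy : y ∈ tube S r) (hgood : -unitNormal S y ∈ normalCone S r (footPoint S y))
    (hτ : ‖τ‖ = 1) (hτn : inner ℝ τ (unitNormal S y) = 0)
    (hder : HasDerivAt (fun h : ℝ => footPoint S (y + h • τ)) 0 0) :
    τ ∈ normalCone S r (footPoint S y) := by
  by_contra hcon
  have hr := H.pos
  have hp := H.footPoint_mem hy
  have hn := H.norm_unitNormal hy
  have hnK := H.unitNormal_mem_normalCone hy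
  have hyp := footPoint_add (S := S) y
  have hd : 0 < infDist y S := hy.1
  have hdr : infDist y S < r := hy.2
  have hlo := (hasDerivAt_iff_isLittleO.mp hder).def (show (0 : ℝ) < 1 / 8 by norm_num)
  simp only [sub_zero, zero_smul, add_zero, smul_zero] at hlo
  set p := footPoint S y
  set n := unitNormal S y
  have hcont : Continuous fun h : ℝ => y + h • τ := by fun_prop
  have htube : ∀ᶠ h : ℝ in 𝓝 0, y + h • τ ∈ tube S r :=
    hcont.continuousAt.eventually (by simpa using (isOpen_tube S r).mem_nhds hy)
  obtain ⟨ε, hε, hball⟩ := Metric.eventually_nhds_iff.mp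
    ((hlo.and htube).and (gt_mem_nhds hr))
  have hmain : ∀ h ∈ Ico 0 ε, ‖footPoint S (y + h • τ) - p‖ ≤ 1 / 8 * h ∧
      y + h • τ ∈ tube S r ∧ h < r := by
    intro h hh
    have h1 := hball (y := h) (by rw [Real.dist_eq, sub_zero, abs_of_nonneg hh.1]; exact hh.2)
    rw [Real.norm_of_nonneg hh.1] at h1
    exact ⟨h1.1.1, h1.1.2, h1.2⟩
  have hne : ∀ h ∈ Ioo 0 ε, footPoint S (y + h • τ) ≠ p := by
    intro h hh heq
    have ht := (hmain h ⟨hh.1.le, hh.2⟩).2.1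
    have h1 := smul_mem_normalCone ht.1.le (H.unitNormal_mem_normalCone ht)
    have h2 := footPoint_add (S := S) (y + h • τ)
    rw [heq] at h1 h2
    refine hcon (mem_normalCone_of_smul_mem hh.1 ?_)
    have h3 : h • τ = infDist (y + h • τ) S • unitNormal S (y + h • τ) + infDist y S • -n := by
      rw [eq_sub_of_add_eq' h2, smul_neg, eq_sub_of_add_eq' hyp]
      abel
    rw [h3]
    exact H.add_mem_normalCone hp h1 (smul_mem_normalCone hd.le hgood)
  have hbad : ∀ h ∈ Ioo 0 ε,
      -unitNormal S (y + h • τ) ∉ normalCone S r (footPoint S (y + h • τ)) := by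
    intro h hh hg
    obtain ⟨hsmall, ht, hhr⟩ := hmain h ⟨hh.1.le, hh.2⟩
    have hnh := H.norm_unitNormal ht
    have hqh := H.footPoint_mem ht
    have k1 := abs_inner_le hnh (H.unitNormal_mem_normalCone ht) hg hp
    have k2 := abs_inner_le hn hnK hgood hqh
    have hne' := hne h hh
    have hfp := footPoint_add (S := S) (y + h • τ)
    have hdh : 0 < infDist (y + h • τ) S := ht.1
    have hdhr : infDist (y + h • τ) S < r := ht.2
    generalize infDist (y + h • τ) S = d' at *
    generalize unitNormal S (y + h • τ) = n' at *
    generalize footPoint S (y + h • τ) = q at *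
    generalize infDist y S = d at *
    have hw : 0 < ‖q - p‖ := norm_pos_iff.mpr (sub_ne_zero.mpr hne')
    rw [norm_sub_rev p q, ← neg_sub q p, inner_neg_left, abs_neg] at k1
    have hτw : h • τ = (q - p) + d' • n' - d • n := by
      have : h • τ = (q + d' • n') - (p + d • n) := by rw [hfp, hyp]; abel
      rw [this]; abel
    have hi : h * inner ℝ (q - p) τ = ‖q - p‖ ^ 2 + d' * inner ℝ (q - p) n' -
        d * inner ℝ (q - p) n := by
      rw [← inner_smul_right, hτw, inner_sub_right, inner_add_right, real_inner_self_eq_norm_sq,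
        inner_smul_right, inner_smul_right]
    have hpyth : ‖q - p‖ ^ 2 = inner ℝ (q - p) τ ^ 2 + inner ℝ (q - p) n ^ 2 :=
      norm_sq_eq_of_orthonormal hτ hn hτn _
    have hh0 := hh.1
    set w := ‖q - p‖
    set A := inner ℝ (q - p) τ
    set B := inner ℝ (q - p) n
    set B' := inner ℝ (q - p) n'
    have l1 : d' * |B'| ≤ w ^ 2 / 2 := by nlinarith [abs_nonneg B']
    have l2 : d * |B| ≤ w ^ 2 / 2 := by nlinarith [abs_nonneg B]
    have l3 : h * |A| ≤ 2 * w ^ 2 := by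
      rw [← abs_of_pos hh0, ← abs_mul, hi, abs_le]
      have := abs_le.mp (le_refl |B|)
      have := abs_le.mp (le_refl |B'|)
      constructor <;> nlinarith
    have l4 : |B| ≤ w / 2 := by
      by_contra! hc
      nlinarith
    have l5 : w / 2 ≤ |A| := by
      by_contra! hc
      have := sq_abs A
      have := sq_abs B
      nlinarith [abs_nonneg A, abs_nonneg B]
    have l6 : h * (w / 2) ≤ 2 * w ^ 2 := (mul_le_mul_of_nonneg_left l5 hh0.le).trans l3
    have l7 : h / 2 ≤ 2 * w := by
      refine le_of_mul_le_mul_right ?_ hw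
      linarith
    linarith
  have hderiv : ∀ h ∈ Ico 0 ε, HasDerivAt (fun h : ℝ => footPoint S (y + h • τ)) 0 h := by
    intro h hh
    rcases eq_or_lt_of_le hh.1 with rfl | h0
    · exact hder
    · have := H.eventually_footPoint_eq hint (hmain h hh).2.1 (hbad h ⟨h0, hh.2⟩)
      have h2 : (fun h : ℝ => footPoint S (y + h • τ)) =ᶠ[𝓝 h]
          fun _ => footPoint S (y + h • τ) := hcont.continuousAt.eventually this
      exact (hasDerivAt_const h _).congr_of_eventuallyEq h2
  have hlast : ε / 2 ∈ Icc 0 (ε / 2) := ⟨by linarith, le_rfl⟩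
  have := constant_of_has_deriv_right_zero (a := 0) (b := ε / 2)
    (fun s hs => (hderiv s ⟨hs.1, by linarith [hs.2]⟩).continuousAt.continuousWithinAt)
    (fun s hs => (hderiv s ⟨hs.1, by linarith [hs.2]⟩).hasDerivWithinAt) _ hlast
  rw [zero_smul, add_zero] at this
  exact hne (ε / 2) ⟨by linarith, by linarith⟩ this

lemma deriv_footPoint_ne_zero (H : IsProxSmooth S r) (hint : interior S = ∅)
    (hconn : IsConnected S) (hS : ∀ p, S ≠ {p}) {y v : E2}
    (hy : y ∈ tube S r) (hgood : -unitNormal S y ∈ normalCone S r (footPoint S y))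
    (hder : HasDerivAt (fun h : ℝ => footPoint S (y + h • rot (unitNormal S y))) v 0) : v ≠ 0 := by
  rintro rfl
  have hn := H.norm_unitNormal hy
  refine hS _ (H.eq_singleton_of_normals hconn (H.footPoint_mem hy) hn
    (H.unitNormal_mem_normalCone hy) hgood
    (H.mem_normalCone_of_hasDerivAt_zero hint hy hgood (by rw [norm_rot, hn])
      (inner_rot_self _) hder)
    (H.mem_normalCone_of_hasDerivAt_zero hint hy hgood (by rw [norm_neg, norm_rot, hn])
      (by rw [inner_neg_left, inner_rot_self, neg_zero]) ?_))
  have h0 : HasDerivAt (fun h : ℝ => footPoint S (y + h • rot (unitNormal S y))) 0 (-(0 : ℝ)) := by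
    rwa [neg_zero]
  have := h0.scomp (0 : ℝ) (hasDerivAt_neg (0 : ℝ))
  simpa [Function.comp_def] using this

/-- The normal directions of a non-degenerate `S` always come in opposite pairs. -/
lemma neg_unitNormal_mem (H : IsProxSmooth S r) (hint : interior S = ∅)
    (hconn : IsConnected S) (hS : ∀ p, S ≠ {p}) {y : E2} (hy : y ∈ tube S r) :
    -unitNormal S y ∈ normalCone S r (footPoint S y) := by
  by_contra hbad
  have hp := H.footPoint_mem hy
  have hn := H.norm_unitNormal hy
  have hyp := footPoint_add (S := S) y
  have hd : 0 < infDist y S := hy.1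
  have hdr : infDist y S < r := hy.2
  have hconst := H.eventually_footPoint_eq hint hy hbad
  set p := footPoint S y with hpdef
  set n := unitNormal S y
  set t := infDist y S
  let v : ℝ → E2 := fun θ => t • (Real.cos θ • n + Real.sin θ • rot n)
  have hv : ∀ θ, ‖v θ‖ = t := by
    intro θ
    have h1 : ‖Real.cos θ • n + Real.sin θ • rot n‖ ^ 2 = 1 := by
      rw [norm_add_sq_real, norm_smul, norm_smul, inner_smul_left, inner_smul_right,
        real_inner_comm, inner_rot_self, norm_rot, hn]
      simp
    have h2 : ‖Real.cos θ • n + Real.sin θ • rot n‖ = 1 := by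
      nlinarith [norm_nonneg (Real.cos θ • n + Real.sin θ • rot n)]
    rw [norm_smul, h2, mul_one, Real.norm_of_nonneg hd.le]
  have hvc : Continuous fun θ => p + v θ := by
    simp only [v]; fun_prop
  let B : Set ℝ := {θ | infDist (p + v θ) S = t ∧ fderiv ℝ (footPoint S) (p + v θ) = 0}
  have hin : ∀ θ, infDist (p + v θ) S = t → p + v θ ∈ tube S r ∧ footPoint S (p + v θ) = p := by
    intro θ h
    obtain ⟨h1, h2, -⟩ := H.of_infDist_eq_norm hp (w := v θ) (by rwa [hv]) (by rwa [hv])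
      (by rw [h, hv])
    exact ⟨h1, h2⟩
  have hder0 : ∀ z, (∀ᶠ x in 𝓝 z, footPoint S x = p) → fderiv ℝ (footPoint S) z = 0 := by
    intro z hz
    have h1 : footPoint S =ᶠ[𝓝 z] fun _ => p := hz
    rw [h1.fderiv_eq]
    simp
  have hcl : IsClosed B := by
    have hC : IsClosed {θ | infDist (p + v θ) S = t} :=
      isClosed_eq ((continuous_infDist_pt S).comp hvc) continuous_const
    have hcont : ContinuousOn (fun θ => fderiv ℝ (footPoint S) (p + v θ))
        {θ | infDist (p + v θ) S = t} := by
      intro θ hθ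
      have h1 : ContinuousAt (fderiv ℝ (footPoint S)) (p + v θ) :=
        ((H.contDiffAt_footPoint (hin θ hθ).1).fderiv_right (m := 0) (by norm_num)).continuousAt
      exact (h1.comp (f := fun θ => p + v θ) hvc.continuousAt).continuousWithinAt
    exact hcont.preimage_isClosed_of_isClosed hC isClosed_singleton
  have hop : IsOpen B := by
    rw [isOpen_iff_mem_nhds]
    rintro θ ⟨h1, h2⟩
    obtain ⟨ht, hf⟩ := hin θ h1
    have hbadθ : -unitNormal S (p + v θ) ∉ normalCone S r (footPoint S (p + v θ)) := by
      intro hg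
      refine H.deriv_footPoint_ne_zero hint hconn hS ht hg (v := 0) ?_ rfl
      have hF : HasFDerivAt (footPoint S) (0 : E2 →L[ℝ] E2)
          (p + v θ + (0 : ℝ) • rot (unitNormal S (p + v θ))) := by
        rw [zero_smul, add_zero, ← h2]
        exact ((H.contDiffAt_footPoint ht).differentiableAt (by norm_num)).hasFDerivAt
      have hl : HasDerivAt (fun h : ℝ => p + v θ + h • rot (unitNormal S (p + v θ)))
          (rot (unitNormal S (p + v θ))) 0 := by
        simpa using ((hasDerivAt_id (0 : ℝ)).smul_const
          (rot (unitNormal S (p + v θ)))).const_add (p + v θ)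
      exact hF.comp_hasDerivAt (0 : ℝ) hl
    have hev := H.eventually_footPoint_eq hint ht hbadθ
    rw [hf] at hev
    have hev2 := hev.eventually_nhds.and ((isOpen_tube S r).mem_nhds ht)
    filter_upwards [hvc.continuousAt.eventually hev2] with φ hφ
    refine ⟨?_, hder0 _ hφ.1⟩
    have h3 := footPoint_add (S := S) (p + v φ)
    rw [hφ.1.self_of_nhds] at h3
    have h4 := congrArg norm (add_left_cancel h3)
    rwa [norm_smul, H.norm_unitNormal hφ.2, hv, mul_one,
      Real.norm_of_nonneg infDist_nonneg] at h4
  have h0 : (0 : ℝ) ∈ B := by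
    have : p + v 0 = y := by simpa [v] using hyp
    refine ⟨by rw [this], ?_⟩
    rw [this]
    exact hder0 y hconst
  have hu : B = univ := IsClopen.eq_univ ⟨hcl, hop⟩ ⟨0, h0⟩
  have hπ : Real.pi ∈ B := by rw [hu]; trivial
  have hvπ : v Real.pi = t • -n := by simp [v]
  have h5 := hπ.1
  have h6 := hv Real.pi
  rw [hvπ] at h5 h6
  exact hbad (mem_normalCone_of_smul_mem hd (H.mem_normalCone_of_infDist hp (by rwa [h6])
    (by rwa [h6]) (by rw [h5, h6])))
end IsProxSmooth

lemma ContDiffAt.exists_contDiff_eventuallyEq {g : ℝ → ℝ} (hg : ContDiffAt ℝ 2 g 0) :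
    ∃ f : ℝ → ℝ, ContDiff ℝ 2 f ∧ f =ᶠ[𝓝 0] g := by
  obtain ⟨ρ, hρ, hball⟩ := Metric.eventually_nhds_iff_ball.mp (hg.eventually (by simp))
  let φ : ContDiffBump (0 : ℝ) := ⟨ρ / 4, ρ / 2, by positivity, by linarith⟩
  refine ⟨fun x => φ x * g x, contDiff_iff_contDiffAt.mpr fun x => ?_, ?_⟩
  · by_cases hx : x ∈ ball (0 : ℝ) ρ
    · exact φ.contDiff.contDiffAt.mul (hball x hx)
    · have hev : (fun x => φ x * g x) =ᶠ[𝓝 x] fun _ => 0 := by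
        have hd : ρ / 2 < Dist.dist x 0 := by
          have := not_lt.mp (fun h => hx (mem_ball.mpr h))
          linarith
        filter_upwards [(continuous_id.dist continuous_const : Continuous fun y : ℝ => Dist.dist y 0).continuousAt.eventually
          (lt_mem_nhds hd)] with y hy
        exact mul_eq_zero_of_left (φ.zero_of_le_dist (le_of_lt hy)) _
      exact contDiffAt_const.congr_of_eventuallyEq hev
  · filter_upwards [closedBall_mem_nhds (0 : ℝ) (show 0 < ρ / 4 by positivity)] with y hy
    rw [φ.one_of_mem_closedBall hy, one_mul]

lemma ContDiffAt.exists_right_inverse {a : ℝ → ℝ} (ha : ContDiffAt ℝ 1 a 0) (h0 : a 0 = 0)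
    (hd : deriv a 0 ≠ 0) :
    ∃ η : ℝ → ℝ, ContDiffAt ℝ 1 η 0 ∧ η 0 = 0 ∧ ∀ᶠ s in 𝓝 0, a (η s) = s := by
  have hf : HasFDerivAt a
      (↑(ContinuousLinearEquiv.unitsEquivAut ℝ (Units.mk0 (deriv a 0) hd)) : ℝ →L[ℝ] ℝ) 0 := by
    have hstr := ha.hasStrictDerivAt one_ne_zero
    exact (hstr.hasStrictFDerivAt_equiv hd).hasFDerivAt
  refine ⟨ha.localInverse hf one_ne_zero, ?_, ?_, ?_⟩
  · simpa [h0] using ha.to_localInverse hf one_ne_zero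
  · simpa [h0] using ha.localInverse_apply_image hf one_ne_zero
  · simpa [h0, ContDiffAt.localInverse] using
      (ha.hasStrictFDerivAt' hf one_ne_zero).eventually_right_inverse

/-- If the curve `(a, b)` is orthogonal to the `C¹` field `(α, β)`, then its reparametrization as a
graph is `C²`. -/
lemma contDiffAt_two_comp_of_deriv_mul_add_eq_zero {a b α β η : ℝ → ℝ}
    (ha : ContDiffAt ℝ 1 a 0) (hb : ContDiffAt ℝ 1 b 0) (hη : ContDiffAt ℝ 1 η 0)
    (hα : ContDiffAt ℝ 1 α 0) (hβ : ContDiffAt ℝ 1 β 0) (hη0 : η 0 = 0) (hβ0 : β 0 ≠ 0)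
    (horth : ∀ᶠ h in 𝓝 0, deriv a h * α h + deriv b h * β h = 0)
    (hinv : ∀ᶠ s in 𝓝 0, a (η s) = s) : ContDiffAt ℝ 2 (fun s => b (η s)) 0 := by
  have ht : Tendsto η (𝓝 0) (𝓝 0) := by simpa [hη0] using hη.continuousAt.tendsto
  have hα' : ContDiffAt ℝ 1 (fun s => α (η s)) 0 :=
    ContDiffAt.comp 0 (by simpa [hη0] using hα) hη
  have hβ' : ContDiffAt ℝ 1 (fun s => β (η s)) 0 :=
    ContDiffAt.comp 0 (by simpa [hη0] using hβ) hη
  have hψ : ContDiffAt ℝ 1 (fun s => -α (η s) / β (η s)) 0 :=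
    hα'.neg.div hβ' (by simpa [hη0] using hβ0)
  have hne : ∀ᶠ s in 𝓝 0, β (η s) ≠ 0 :=
    ht.eventually (hβ.continuousAt.eventually_ne hβ0)
  have hder : ∀ᶠ s in 𝓝 0, HasDerivAt (fun s => b (η s)) (-α (η s) / β (η s)) s := by
    filter_upwards [ht.eventually (ha.eventually (by simp)),
      ht.eventually (hb.eventually (by simp)), hη.eventually (by simp), ht.eventually horth,
      hinv.eventually_nhds, hne] with s h1 h2 h3 h4 h5 h6
    have da := (h1.differentiableAt one_ne_zero).hasDerivAt
    have db := (h2.differentiableAt one_ne_zero).hasDerivAt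
    have dη := (h3.differentiableAt one_ne_zero).hasDerivAt
    have e1 : deriv a (η s) * deriv η s = 1 :=
      (da.comp s dη).unique ((hasDerivAt_id s).congr_of_eventuallyEq h5)
    have e2 : deriv b (η s) * deriv η s = -α (η s) / β (η s) := by
      rw [eq_div_iff h6]
      linear_combination (deriv η s) * h4 - α (η s) * e1
    rw [← e2]
    exact db.comp s dη
  have h2 : (2 : WithTop ℕ∞) = ((1 : ℕ) : WithTop ℕ∞) + 1 := by norm_num
  rw [h2, contDiffAt_succ_iff_hasFDerivAt]
  refine ⟨fun s => ContinuousLinearMap.toSpanSingleton ℝ (-α (η s) / β (η s)),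
    ⟨_, hder, fun s hs => hs.hasFDerivAt⟩, ?_⟩
  have hL : ContDiff ℝ 1 (fun c : ℝ => ContinuousLinearMap.toSpanSingleton ℝ c) :=
    (ContinuousLinearMap.toSpanSingletonCLE (𝕜 := ℝ) (E := ℝ)).contDiff
  exact hL.contDiffAt.comp 0 hψ

lemma exists_rigid_motion (p : E2) {τ n : E2} (hτ : ‖τ‖ = 1) (hn : ‖n‖ = 1)
    (h : inner ℝ τ n = 0) :
    ∃ e : E2 ≃ᵃⁱ[ℝ] E2, ∀ q, e q = pt (inner ℝ (q - p) τ) (inner ℝ (q - p) n) := by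
  let L : E2 →ₗ[ℝ] E2 :=
    { toFun := fun x => pt (inner ℝ x τ) (inner ℝ x n)
      map_add' := fun x y => by
        ext i; fin_cases i <;> simp [inner_add_left]
      map_smul' := fun c x => by
        ext i; fin_cases i <;> simp [inner_smul_left] }
  let L' : E2 →ₗᵢ[ℝ] E2 := ⟨L, fun x => by
    rw [← sq_eq_sq₀ (norm_nonneg _) (norm_nonneg _), norm_sq_eq_of_orthonormal hτ hn h x,
      norm_sq_eq_coord]
    rfl⟩
  exact ⟨(AffineIsometryEquiv.vaddConst ℝ p).symm.trans
    (L'.toLinearIsometryEquiv rfl).toAffineIsometryEquiv, fun q => rfl⟩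

namespace IsProxSmooth
variable {S : Set E2} {r : ℝ}

lemma inner_deriv_footPoint (H : IsProxSmooth S r) (hint : interior S = ∅)
    (hconn : IsConnected S) (hS : ∀ p, S ≠ {p}) {y τ : E2} {h : ℝ} (hy : y + h • τ ∈ tube S r) :
    inner ℝ (deriv (fun t : ℝ => footPoint S (y + t • τ)) h) (unitNormal S (y + h • τ)) = 0 := by
  set γ : ℝ → E2 := fun t => footPoint S (y + t • τ) with hγ
  set n := unitNormal S (y + h • τ)
  have hl : ContDiff ℝ 1 (fun t : ℝ => y + t • τ) := by fun_prop
  have hd : HasDerivAt γ (deriv γ h) h := by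
    have : ContDiffAt ℝ 1 γ h := ContDiffAt.comp (g := footPoint S) h (H.contDiffAt_footPoint hy) hl.contDiffAt
    exact (this.differentiableAt one_ne_zero).hasDerivAt
  have hd' : HasDerivAt (fun t => γ t - γ h) (deriv γ h) h := hd.sub_const _
  have hG : HasDerivAt (fun t => ‖γ t - γ h‖ ^ 2 - 2 * r * inner ℝ (γ t - γ h) n)
      (2 * inner ℝ (γ h - γ h) (deriv γ h) -
        2 * r * (inner ℝ (γ h - γ h) (0 : E2) + inner ℝ (deriv γ h) n)) h :=
    hd'.norm_sq.sub ((hd'.inner ℝ (hasDerivAt_const h n)).const_mul _)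
  have hmin : IsLocalMin (fun t => ‖γ t - γ h‖ ^ 2 - 2 * r * inner ℝ (γ t - γ h) n) h := by
    filter_upwards [hl.continuous.continuousAt.eventually ((isOpen_tube S r).mem_nhds hy)]
      with t ht
    have := IsProxSmooth.abs_inner_le (H.norm_unitNormal hy) (H.unitNormal_mem_normalCone hy)
      (H.neg_unitNormal_mem hint hconn hS hy) (H.footPoint_mem ht)
    have h2 := mul_le_mul_of_nonneg_left (le_abs_self (inner ℝ (γ t - γ h) n))
      (show 0 ≤ 2 * r by linarith [H.pos])
    simp only [sub_self, norm_zero, inner_zero_left]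
    linarith
  have := hmin.hasDerivAt_eq_zero hG
  simp only [sub_self, inner_zero_left, mul_zero, zero_add, zero_sub, neg_eq_zero] at this
  have hr := H.pos
  exact (mul_eq_zero.mp this).resolve_left (by positivity)

lemma isC2GraphAt (H : IsProxSmooth S r) (hint : interior S = ∅)
    (hconn : IsConnected S) (hS : ∀ p, S ≠ {p}) {p : E2} (hp : p ∈ S) : IsC2GraphAt S p := by
  have hr := H.pos
  obtain ⟨n, hn, hnK, hnK'⟩ := H.exists_opposite_normals hint hp
  have hw : ‖(r / 2) • n‖ = r / 2 := by
    rw [norm_smul, hn, mul_one, Real.norm_of_nonneg (by positivity)]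
  obtain ⟨hx, hfoot, hnor⟩ := H.of_infDist_eq_norm hp (w := (r / 2) • n) (by rw [hw]; positivity)
    (by rw [hw]; linarith)
    (H.infDist_add_of_mem_normalCone hp (by rw [hw]; linarith)
      (smul_mem_normalCone (by positivity) hnK))
  rw [hw] at hnor
  have hnor : unitNormal S (p + (r / 2) • n) = n :=
    smul_right_injective E2 (show r / 2 ≠ 0 by positivity) hnor
  set y := p + (r / 2) • n with hy
  set τ := rot n with hτ
  have hτ1 : ‖τ‖ = 1 := (norm_rot n).trans hn
  have hτn : inner ℝ τ n = 0 := inner_rot_self n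
  have hl : ContDiff ℝ 1 (fun t : ℝ => y + t • τ) := by fun_prop
  have hy0 : y + (0 : ℝ) • τ = y := by simp
  set γ : ℝ → E2 := fun t => footPoint S (y + t • τ) with hγ
  set N : ℝ → E2 := fun t => unitNormal S (y + t • τ) with hN
  have hγ0 : γ 0 = p := by simp only [hγ, hy0, hfoot]
  have hN0 : N 0 = n := by simp only [hN, hy0, hnor]
  have cγ : ContDiffAt ℝ 1 γ 0 :=
    ContDiffAt.comp (g := footPoint S) (0 : ℝ) (H.contDiffAt_footPoint (by simpa using hx)) hl.contDiffAt
  have cN : ContDiffAt ℝ 1 N 0 :=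
    ContDiffAt.comp (g := unitNormal S) (0 : ℝ) (H.contDiffAt_unitNormal (by simpa using hx)) hl.contDiffAt
  have htube : ∀ᶠ t in 𝓝 (0 : ℝ), y + t • τ ∈ tube S r :=
    hl.continuous.continuousAt.eventually ((isOpen_tube S r).mem_nhds (by simpa using hx))
  set a : ℝ → ℝ := fun t => inner ℝ (γ t - p) τ with ha
  set b : ℝ → ℝ := fun t => inner ℝ (γ t - p) n with hb
  have ca : ContDiffAt ℝ 1 a 0 := (cγ.sub contDiffAt_const).inner ℝ contDiffAt_const
  have cb : ContDiffAt ℝ 1 b 0 := (cγ.sub contDiffAt_const).inner ℝ contDiffAt_const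
  have cα : ContDiffAt ℝ 1 (fun t => inner ℝ (N t) τ) 0 := cN.inner ℝ contDiffAt_const
  have cβ : ContDiffAt ℝ 1 (fun t => inner ℝ (N t) n) 0 := cN.inner ℝ contDiffAt_const
  have ha0 : a 0 = 0 := by simp [ha, hγ0]
  have hb0 : b 0 = 0 := by simp [hb, hγ0]
  have hβ0 : (inner ℝ (N 0) n : ℝ) = 1 := by
    rw [hN0, real_inner_self_eq_norm_sq, hn, one_pow]
  have hder : ∀ t (m : E2), DifferentiableAt ℝ γ t →
      deriv (fun t => inner ℝ (γ t - p) m) t = inner ℝ (deriv γ t) m := by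
    intro t m ht
    have h := ((ht.hasDerivAt.sub_const p).inner ℝ (hasDerivAt_const t m)).deriv
    rwa [inner_zero_right, zero_add] at h
  have hdec : ∀ x : E2, x = inner ℝ x n • n + inner ℝ x τ • τ := eq_smul_add_smul_rot hn
  have dγ : ∀ᶠ t in 𝓝 0, DifferentiableAt ℝ γ t :=
    (cγ.eventually (by simp)).mono fun t ht => ht.differentiableAt one_ne_zero
  have horth : ∀ᶠ t in 𝓝 0, deriv a t * inner ℝ (N t) τ + deriv b t * inner ℝ (N t) n = 0 := by
    filter_upwards [dγ, htube] with t h1 h2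
    rw [hder t τ h1, hder t n h1]
    have h3 : inner ℝ (deriv γ t) (N t) = 0 := H.inner_deriv_footPoint hint hconn hS h2
    conv_lhs at h3 => rw [hdec (deriv γ t)]
    rw [inner_add_left, real_inner_smul_left, real_inner_smul_left, real_inner_comm (N t) n,
      real_inner_comm (N t) τ] at h3
    linarith
  have hda : deriv a 0 ≠ 0 := by
    intro h0
    have h1 := horth.self_of_nhds
    rw [h0, zero_mul, zero_add, hβ0, mul_one] at h1
    rw [hder 0 τ dγ.self_of_nhds] at h0
    rw [hder 0 n dγ.self_of_nhds] at h1
    have h2 : deriv γ 0 = 0 := by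
      rw [hdec (deriv γ 0), h0, h1]; simp
    refine H.deriv_footPoint_ne_zero hint hconn hS hx ?_ ?_ h2
    · rwa [hfoot, hnor]
    · rw [hnor]
      exact dγ.self_of_nhds.hasDerivAt
  obtain ⟨η, cη, hη0, hinv⟩ := ca.exists_right_inverse ha0 hda
  obtain ⟨g, hg, hgb⟩ := (contDiffAt_two_comp_of_deriv_mul_add_eq_zero ca cb cη cα cβ hη0
    (by rw [hβ0]; exact one_ne_zero) horth hinv).exists_contDiff_eventuallyEq
  have ht : Tendsto η (𝓝 0) (𝓝 0) := by simpa [hη0] using cη.continuousAt.tendsto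
  have hbsmall : ∀ᶠ t in 𝓝 0, |b t| < r / 2 :=
    cb.continuousAt.abs.eventually_lt_const (by simp only [hb0, abs_zero]; positivity)
  have hβbig : ∀ᶠ t in 𝓝 0, 1 / 2 < inner ℝ (N t) n :=
    cβ.continuousAt.eventually_const_lt (hβ0.symm ▸ by norm_num : (1 / 2 : ℝ) < inner ℝ (N 0) n)
  obtain ⟨s, hs, hball⟩ := Metric.eventually_nhds_iff.mp
    (((hinv.and hgb).and (ht.eventually htube)).and (ht.eventually (hbsmall.and hβbig)))
  simp only [Real.dist_eq, sub_zero] at hball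
  obtain ⟨e, he⟩ := exists_rigid_motion p hτ1 hn hτn
  refine ⟨e, {q | |inner ℝ (q - p) τ| < s ∧ |inner ℝ (q - p) n| < r / 2}, g, -s, s, ?_, ?_,
    by linarith, hg, ?_⟩
  · exact (isOpen_lt (f := fun q => |inner ℝ (q - p) τ|) (by fun_prop) continuous_const).inter
      (isOpen_lt (f := fun q => |inner ℝ (q - p) n|) (by fun_prop) continuous_const)
  · simp [hs, hr]
  · ext z
    constructor
    · rintro ⟨q, ⟨hqS, hq1, hq2⟩, rfl⟩
      obtain ⟨⟨⟨h1, h2⟩, h3⟩, h4, h5⟩ := hball hq1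
      refine ⟨inner ℝ (q - p) τ, abs_lt.mp hq1, ?_⟩
      set t := inner ℝ (q - p) τ with ht'
      rw [he q, ← ht']
      change pt t (g t) = _
      rw [h2]
      congr 1
      have hc : q - γ (η t) = (inner ℝ (q - p) n - b (η t)) • n := by
        rw [hdec (q - γ (η t))]
        have e1 : q - γ (η t) = (q - p) - (γ (η t) - p) := by abel
        rw [e1, inner_sub_left, inner_sub_left _ _ τ, ← ht']
        have e2 : inner ℝ (γ (η t) - p) τ = t := h1
        rw [e2, sub_self, zero_smul, add_zero]
      set c := inner ℝ (q - p) n - b (η t) with hcdef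
      have habs := IsProxSmooth.abs_inner_le (H.norm_unitNormal h3) (H.unitNormal_mem_normalCone h3)
        (H.neg_unitNormal_mem hint hconn hS h3) hqS
      change 2 * r * |inner ℝ (q - γ (η t)) (N (η t))| ≤ ‖q - γ (η t)‖ ^ 2 at habs
      rw [hc, real_inner_smul_left, real_inner_comm, abs_mul, abs_of_pos (a := inner ℝ (N (η t)) n)
        (by linarith), norm_smul, hn, mul_one, Real.norm_eq_abs] at habs
      have hcr : |c| < r := by
        have := abs_sub (inner ℝ (q - p) n) (b (η t))
        linarith
      have hc0 : c = 0 := by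
        by_contra hne
        have hpos := abs_pos.mpr hne
        nlinarith [mul_pos (mul_pos hr hpos) (sub_pos.mpr h5), mul_pos hpos (sub_pos.mpr hcr)]
      linarith
    · rintro ⟨t, ht1, rfl⟩
      obtain ⟨⟨⟨h1, h2⟩, h3⟩, h4, h5⟩ := hball (abs_lt.mpr ht1)
      refine ⟨γ (η t), ⟨H.footPoint_mem h3, ?_, h4⟩, ?_⟩
      · change |a (η t)| < s
        rw [h1]
        exact abs_lt.mpr ht1
      · rw [he]
        change pt (a (η t)) (b (η t)) = pt t (g t)
        rw [h1, h2]

end IsProxSmooth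

/-- **Theorem (characterization of planar proximally `C²` sets with empty interior).**
If `S ⊆ ℝ²` is nonempty, closed, connected, has empty interior, and is proximally `C²`
of some radius `r_S > 0`, then `S` is either a singleton or a `1`-dimensional manifold
without boundary of class `C²`. -/
theorem stmt1 (S : Set E2) (rS : ℝ) (hrS : 0 < rS)
    (hne : S.Nonempty) (hcl : IsClosed S) (hconn : IsConnected S)
    (hint : interior S = ∅)
    (hprox : ContDiffOn ℝ 2 (fun x => infDist x S)
      {x | 0 < infDist x S ∧ infDist x S < rS}) :
    (∃ p, S = {p}) ∨ (∀ p ∈ S, IsC2GraphAt S p) := by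
  by_cases h : ∃ p, S = {p}
  · exact Or.inl h
  · push Not at h
    have H : IsProxSmooth S rS := ⟨hrS, hne, hcl, hprox⟩
    exact Or.inr fun p hp => H.isC2GraphAt hint hconn h hp
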